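/- Let p > 3 be a prime, k ≥ 1 an integer, N = p^{2k}, and let r be an integer with 2r ≡ 1 (mod N). Let x1, x2 be integers. Then for every y ∈ ℤ/Nℤ: p^{−k}·∑_{z ∈ ℤ/Nℤ} ζ_{(x1,x2)}(z)·e(2·r·ỹ·z̃/N) = e(−x1·x2/N)·ζ_{(x2, −x1)}(y), where ỹ, z̃ ∈ ℤ are any representatives of y, z (both sides are independent of these choices). -/

import Mathlib

/-- `e(x) = exp(2πix)`. -/
noncomputable def e (x : ℝ) : ℂ := Complex.exp (2 * Real.pi * Complex.I * x)

theorem e_add (x y : ℝ) : e (x + y) = e x * e y := by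
  simp only [e, ← Complex.exp_add]
  push_cast
  ring_nf

theorem e_natCast_mul (n : ℕ) (x : ℝ) : e (n * x) = e x ^ n := by
  simp only [e, ← Complex.exp_nat_mul]
  push_cast
  ring_nf

theorem e_eq_one_iff (x : ℝ) : e x = 1 ↔ ∃ n : ℤ, x = n := by
  rw [e, Complex.exp_eq_one_iff]
  refine exists_congr fun n => ?_
  rw [mul_comm, mul_left_inj' Complex.two_pi_I_ne_zero]
  norm_cast

theorem e_div_eq_one_iff {n : ℕ} (hn : n ≠ 0) (a : ℤ) :
    e ((a : ℝ) / n) = 1 ↔ (n : ℤ) ∣ a := by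
  have hn' : (n : ℝ) ≠ 0 := Nat.cast_ne_zero.mpr hn
  rw [e_eq_one_iff]
  refine exists_congr fun m => ?_
  rw [div_eq_iff hn', mul_comm]
  norm_cast

theorem e_div_congr {n : ℕ} (hn : n ≠ 0) {a b : ℤ} (h : (a : ZMod n) = b) :
    e ((a : ℝ) / n) = e ((b : ℝ) / n) := by
  have hd : (n : ℤ) ∣ a - b := by
    exact (ZMod.intCast_eq_intCast_iff_dvd_sub b a n).mp h.symm
  have hab : (a : ℝ) / n = ((a - b : ℤ) : ℝ) / n + (b : ℝ) / n := by
    push_cast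
    ring
  rw [hab, e_add, (e_div_eq_one_iff hn _).mpr hd, one_mul]

/-- Orthogonality of the additive characters modulo `n`. -/
theorem sum_range_e_div {n : ℕ} (hn : n ≠ 0) (c : ℤ) :
    ∑ t ∈ Finset.range n, e (((c * t : ℤ) : ℝ) / n) = if (n : ℤ) ∣ c then (n : ℂ) else 0 := by
  have hn' : (n : ℝ) ≠ 0 := Nat.cast_ne_zero.mpr hn
  have hterm : ∀ t : ℕ, e (((c * t : ℤ) : ℝ) / n) = e ((c : ℝ) / n) ^ t := fun t => by
    rw [← e_natCast_mul]
    push_cast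
    ring_nf
  simp only [hterm]
  split_ifs with h
  · simp [(e_div_eq_one_iff hn c).mpr h]
  · have hne : e ((c : ℝ) / n) ≠ 1 := fun h' => h ((e_div_eq_one_iff hn c).mp h')
    have hpow : e ((c : ℝ) / n) ^ n = 1 := by
      rw [← e_natCast_mul, mul_div_cancel₀ _ hn', e_eq_one_iff]
      exact ⟨c, rfl⟩
    rw [geom_sum_eq hne, hpow, sub_self, zero_div]

/-- A sum over `ℤ/q²ℤ` of a function supported on the class of `a` modulo `q`. -/
theorem sum_eq_sum_range_of_support {q N : ℕ} [NeZero N] (hN : N = q * q) (a : ℤ)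
    (f : ZMod N → ℂ) (hf : ∀ z, (¬ ∃ t : ℤ, z = (a : ZMod N) + (q : ZMod N) * t) → f z = 0) :
    ∑ z, f z = ∑ t ∈ Finset.range q, f ((a : ZMod N) + (q : ZMod N) * ((t : ℤ) : ZMod N)) := by
  have hq : (q : ℤ) ≠ 0 := by
    rintro h
    exact NeZero.ne N (by simp_all)
  have key : ∀ s t : ℤ, (a : ZMod N) + (q : ZMod N) * s = (a : ZMod N) + (q : ZMod N) * t ↔
      (q : ℤ) ∣ t - s := fun s t => by
    have h : (q : ZMod N) * (s : ZMod N) = q * t ↔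
        ((q * s : ℤ) : ZMod N) = ((q * t : ℤ) : ZMod N) := by push_cast; rfl
    rw [add_right_inj, h, ZMod.intCast_eq_intCast_iff_dvd_sub, hN, Nat.cast_mul, ← mul_sub,
      mul_dvd_mul_iff_left hq]
  symm
  refine Finset.sum_of_injOn (fun t : ℕ => (a : ZMod N) + (q : ZMod N) * ((t : ℤ) : ZMod N))
    ?_ (fun _ _ => Finset.mem_coe.mpr (Finset.mem_univ _)) ?_ (fun _ _ => rfl)
  · intro s hs t ht hst
    have hd := (key s t).mp hst
    have hmod : s ≡ t [MOD q] := Nat.modEq_iff_dvd.mpr hd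
    exact hmod.eq_of_lt_of_lt (by simpa using hs) (by simpa using ht)
  · intro z _ hz
    refine hf z ?_
    rintro ⟨t, rfl⟩
    refine hz ⟨(t % q).toNat, ?_, ?_⟩
    · have := Int.emod_lt_of_pos t (b := q) (by omega)
      have := Int.emod_nonneg t hq
      simp only [Finset.coe_range, Set.mem_Iio]
      omega
    · refine (key _ _).mpr ?_
      rw [Int.toNat_of_nonneg (Int.emod_nonneg t hq)]
      exact Int.dvd_self_sub_emod

theorem stmt8 (p k : ℕ) [NeZero p] (hp : p.Prime) (hp3 : 3 < p) (hk : 1 ≤ k)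
    (r : ℤ) (hr : ((2 * r : ℤ) : ZMod (p ^ (2 * k))) = 1)
    -- `ζ x1 x2` is the function `ζ_{(x1,x2)} : ℤ/Nℤ → ℂ`, `N = p^{2k}`, characterized by:
    (ζ : ℤ → ℤ → ZMod (p ^ (2 * k)) → ℂ)
    (hζ : ∀ x1 x2 t : ℤ,
      ζ x1 x2 ((x2 : ZMod (p ^ (2 * k))) +
          (p : ZMod (p ^ (2 * k))) ^ k * ((t : ℤ) : ZMod (p ^ (2 * k)))) =
        e (((x1 * t : ℤ) : ℝ) / (p : ℝ) ^ k))
    (hζ0 : ∀ x1 x2 : ℤ, ∀ y : ZMod (p ^ (2 * k)),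
      (¬ ∃ t : ℤ, y = (x2 : ZMod (p ^ (2 * k))) +
          (p : ZMod (p ^ (2 * k))) ^ k * ((t : ℤ) : ZMod (p ^ (2 * k)))) → ζ x1 x2 y = 0)
    (x1 x2 : ℤ)
    (rep : ZMod (p ^ (2 * k)) → ℤ) (hrep : ∀ y, ((rep y : ℤ) : ZMod (p ^ (2 * k))) = y) :
    ∀ y : ZMod (p ^ (2 * k)),
      ((p : ℂ) ^ k)⁻¹ *
          ∑ z : ZMod (p ^ (2 * k)),
            ζ x1 x2 z * e (((2 * r * rep y * rep z : ℤ) : ℝ) / (p : ℝ) ^ (2 * k)) =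
        e (((-(x1 * x2) : ℤ) : ℝ) / (p : ℝ) ^ (2 * k)) * ζ x2 (-x1) y := by
  intro y
  obtain ⟨q, hq⟩ : ∃ q : ℕ, q = p ^ k := ⟨_, rfl⟩
  have hN : p ^ (2 * k) = q * q := by rw [hq, two_mul, pow_add]
  have hN0 : p ^ (2 * k) ≠ 0 := NeZero.ne _
  have hq0 : q ≠ 0 := hq ▸ pow_ne_zero k (NeZero.ne p)
  have hqR : (q : ℝ) ≠ 0 := Nat.cast_ne_zero.mpr hq0
  have hqC : (q : ℂ) ≠ 0 := Nat.cast_ne_zero.mpr hq0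
  have hqz : (p : ZMod (p ^ (2 * k))) ^ k = (q : ZMod (p ^ (2 * k))) := by rw [hq, Nat.cast_pow]
  have hqr : (p : ℝ) ^ k = q := by rw [hq, Nat.cast_pow]
  have hqc : (p : ℂ) ^ k = q := by rw [hq, Nat.cast_pow]
  have hNr : (p : ℝ) ^ (2 * k) = ((p ^ (2 * k) : ℕ) : ℝ) := by rw [Nat.cast_pow]
  have hNq : ((p ^ (2 * k) : ℕ) : ℝ) = q * q := by rw [hN, Nat.cast_mul]
  simp only [hqz, hqr] at hζ hζ0
  rw [hqc, hNr, sum_eq_sum_range_of_support hN x2 _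
    fun z hz => by rw [hζ0 x1 x2 z hz, zero_mul]]
  have hterm : ∀ t : ℕ,
      ζ x1 x2 ((x2 : ZMod (p ^ (2 * k))) + (q : ZMod (p ^ (2 * k))) * ((t : ℤ) : ZMod _)) *
        e (((2 * r * rep y * rep ((x2 : ZMod (p ^ (2 * k))) +
          (q : ZMod (p ^ (2 * k))) * ((t : ℤ) : ZMod _)) : ℤ) : ℝ) / (p ^ (2 * k) : ℕ)) =
      e (((rep y * x2 : ℤ) : ℝ) / (p ^ (2 * k) : ℕ)) *
        e ((((rep y + x1) * t : ℤ) : ℝ) / q) := fun t => by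
    have hcongr : ((2 * r * rep y * rep ((x2 : ZMod (p ^ (2 * k))) +
          (q : ZMod (p ^ (2 * k))) * ((t : ℤ) : ZMod _)) : ℤ) : ZMod (p ^ (2 * k))) =
        ((rep y * (x2 + q * t) : ℤ) : ZMod (p ^ (2 * k))) := by
      rw [Int.cast_mul, Int.cast_mul, hr, hrep, hrep]
      push_cast
      rw [hrep, one_mul]
    rw [hζ, e_div_congr hN0 hcongr, ← e_add, ← e_add, hNq]
    congr 1
    push_cast
    field_simp
    ring
  rw [Finset.sum_congr rfl fun t _ => hterm t, ← Finset.mul_sum, sum_range_e_div hq0]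
  split_ifs with h
  · obtain ⟨s, hs⟩ := h
    have hrepy : rep y = -x1 + q * s := by linarith
    have hy : y = ((-x1 : ℤ) : ZMod (p ^ (2 * k))) + (q : ZMod (p ^ (2 * k))) * (s : ℤ) := by
      rw [← hrep y, hrepy]
      push_cast
      rfl
    have hζy : ζ x2 (-x1) y = e (((x2 * s : ℤ) : ℝ) / q) := by rw [← hζ x2 (-x1) s, ← hy]
    rw [hζy, ← e_add, mul_left_comm, inv_mul_cancel₀ hqC, mul_one, hrepy, hNq]
    congr 1
    push_cast
    field_simp
  · rw [hζ0 x2 (-x1) y, mul_zero, mul_zero, mul_zero]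
    rintro ⟨s, hs⟩
    refine h ?_
    have hd : ((p ^ (2 * k) : ℕ) : ℤ) ∣ rep y - (-x1 + q * s) := by
      refine (ZMod.intCast_eq_intCast_iff_dvd_sub _ _ _).mp ?_
      rw [hrep, hs]
      push_cast
      rfl
    have hd' : (q : ℤ) ∣ rep y - (-x1 + q * s) :=
      (Int.natCast_dvd_natCast.mpr ⟨q, hN⟩).trans hd
    have hsum : rep y + x1 = rep y - (-x1 + q * s) + q * s := by ring
    rw [hsum]
    exact dvd_add hd' (dvd_mul_right _ _)
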